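/- The Makar-Limanov invariant of the Koras-Russell cubic threefold X = {x + x²y + z² + t³ = 0} is contained in ℂ[x]; i.e. every regular function on X invariant under all 𝔾_a-actions (equivalently, in the kernel of every locally nilpotent derivation of the coordinate ring) is a polynomial in x. -/

import Mathlib

set_option synthInstance.maxHeartbeats 1000000
set_option maxHeartbeats 1000000

open MvPolynomial

/-- The defining polynomial `x + x²y + z² + t³` of the Koras-Russell cubic threefold
(variables `0 ↦ x`, `1 ↦ y`, `2 ↦ z`, `3 ↦ t`). -/
noncomputable def f14 : MvPolynomial (Fin 4) ℂ :=
  X 0 + (X 0) ^ 2 * X 1 + (X 2) ^ 2 + (X 3) ^ 3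

/-- The coordinate ring `A = ℂ[x,y,z,t]/(x + x²y + z² + t³)` of the Koras-Russell cubic. -/
abbrev A14 : Type := MvPolynomial (Fin 4) ℂ ⧸ Ideal.span {f14}

theorem Derivation.pow_add_mul_eq_zero {R A : Type*} [CommRing R] [CommRing A] [Algebra R A]
    (d : Derivation R A A) (n m : ℕ) (a b : A) (ha : (d.toLinearMap ^ n) a = 0)
    (hb : (d.toLinearMap ^ m) b = 0) : (d.toLinearMap ^ (n + m)) (a * b) = 0 := by
  obtain ⟨k, hk⟩ : ∃ k, n + m = k := ⟨_, rfl⟩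
  induction k generalizing n m a b with
  | zero =>
    obtain ⟨rfl, rfl⟩ : n = 0 ∧ m = 0 := by omega
    simp_all
  | succ k ih =>
    rcases n with _ | n
    · simp_all
    rcases m with _ | m
    · simp_all
    have h₁ := ih n (m + 1) (d a) b (by simpa [pow_succ] using ha) hb (by omega)
    have h₂ := ih (n + 1) m a (d b) ha (by simpa [pow_succ] using hb) (by omega)
    rw [hk, pow_succ, Module.End.mul_apply, show d.toLinearMap (a * b) = _ from
      d.leibniz a b, map_add]
    rw [show n + (m + 1) = k by omega] at h₁
    rw [show n + 1 + m = k by omega] at h₂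
    rw [smul_eq_mul, smul_eq_mul, mul_comm b]
    simpa using congr($h₂ + $h₁)

/-- The elements of a ring killed by some power of a given derivation. -/
def Derivation.nilSubalgebra {R A : Type*} [CommRing R] [CommRing A] [Algebra R A]
    (d : Derivation R A A) : Subalgebra R A where
  carrier := {b | ∃ n : ℕ, (d.toLinearMap ^ n) b = 0}
  mul_mem' := fun ⟨n, hn⟩ ⟨m, hm⟩ => ⟨n + m, d.pow_add_mul_eq_zero n m _ _ hn hm⟩
  add_mem' := fun {a b} ⟨n, hn⟩ ⟨m, hm⟩ => ⟨n + m, by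
    rw [map_add, add_comm n m, pow_add, Module.End.mul_apply, hn, ← pow_add, add_comm m n,
      pow_add, Module.End.mul_apply, hm, map_zero, map_zero, add_zero]⟩
  algebraMap_mem' := fun r => ⟨1, by simp⟩

theorem MvPolynomial.notMem_vars_of_pderiv_eq_zero {σ R : Type*} [CommRing R] [IsDomain R]
    [CharZero R] {i : σ} {p : MvPolynomial σ R} (h : pderiv i p = 0) : i ∉ p.vars := by
  intro hi
  obtain ⟨m, hm, him⟩ := (mem_vars_iff_mem_support i).1 hi
  have hc := coeff_pderiv (i := i) p (m - Finsupp.single i 1)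
  rw [h, coeff_zero, tsub_add_cancel_of_le
    (Finsupp.single_le_iff.2 (Nat.one_le_iff_ne_zero.2 (Finsupp.mem_support_iff.1 him)))] at hc
  rcases mul_eq_zero.1 hc.symm with h | h
  · exact mem_support_iff.1 hm h
  · exact Nat.cast_add_one_ne_zero _ h

namespace KorasRussell

/-- The quotient map onto the coordinate ring. -/
noncomputable abbrev proj : MvPolynomial (Fin 4) ℂ →ₐ[ℂ] A14 :=
  Ideal.Quotient.mkₐ ℂ (Ideal.span {f14})

theorem proj_surjective : Function.Surjective proj := Ideal.Quotient.mkₐ_surjective _ _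

theorem proj_eq_zero {p : MvPolynomial (Fin 4) ℂ} : proj p = 0 ↔ f14 ∣ p := by
  rw [Ideal.Quotient.mkₐ_eq_mk, Ideal.Quotient.eq_zero_iff_mem, Ideal.mem_span_singleton]

theorem proj_relation :
    proj (X 0) ^ 2 * proj (X 1) = -(proj (X 0) + proj (X 2) ^ 2 + proj (X 3) ^ 3) := by
  have h : proj f14 = 0 := proj_eq_zero.2 dvd_rfl
  simp only [f14, map_add, map_mul, map_pow] at h
  linear_combination h

/-- The inclusion `ℂ[x, z, t] → ℂ[x, y, z, t]`. -/
noncomputable abbrev incl : MvPolynomial (Fin 3) ℂ →ₐ[ℂ] MvPolynomial (Fin 4) ℂ :=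
  rename (Fin.succAbove 1)

/-- Evaluation at a point of the threefold with values in a `ℂ`-algebra. -/
noncomputable def point {B : Type*} [CommRing B] [Algebra ℂ B] (v : Fin 4 → B)
    (hv : v 0 + v 0 ^ 2 * v 1 + v 2 ^ 2 + v 3 ^ 3 = 0) : A14 →ₐ[ℂ] B :=
  Ideal.Quotient.liftₐ _ (aeval v) fun a ha => by
    obtain ⟨c, rfl⟩ := Ideal.mem_span_singleton.1 ha
    simp [f14, hv]

theorem point_proj {B : Type*} [CommRing B] [Algebra ℂ B] (v : Fin 4 → B)
    (hv : v 0 + v 0 ^ 2 * v 1 + v 2 ^ 2 + v 3 ^ 3 = 0) (p : MvPolynomial (Fin 4) ℂ) :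
    point v hv (proj p) = aeval v p := rfl

theorem proj_incl_injective : Function.Injective fun G => proj (incl G) := by
  let K := FractionRing (MvPolynomial (Fin 3) ℂ)
  let u : Fin 3 → K := fun i => algebraMap (MvPolynomial (Fin 3) ℂ) K (X i)
  have hu : u 0 ≠ 0 := by simp [u]
  let v : Fin 4 → K := ![u 0, -(u 0 + u 1 ^ 2 + u 2 ^ 3) / u 0 ^ 2, u 1, u 2]
  have hv : v 0 + v 0 ^ 2 * v 1 + v 2 ^ 2 + v 3 ^ 3 = 0 := by
    change u 0 + u 0 ^ 2 * (-(u 0 + u 1 ^ 2 + u 2 ^ 3) / u 0 ^ 2) + u 1 ^ 2 + u 2 ^ 3 = 0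
    rw [mul_div_cancel₀ _ (pow_ne_zero 2 hu)]
    ring
  intro G H hGH
  have h : aeval v (incl G) = aeval v (incl H) := congr(point v hv $hGH)
  have key : ∀ G : MvPolynomial (Fin 3) ℂ,
      aeval v (incl G) = algebraMap (MvPolynomial (Fin 3) ℂ) K G := by
    intro G
    change ((aeval v).comp incl) G =
      IsScalarTower.toAlgHom ℂ (MvPolynomial (Fin 3) ℂ) K G
    congr 1
    ext i
    fin_cases i <;> simp [u, v, Fin.succAbove]
  rw [key, key] at h
  exact IsFractionRing.injective (MvPolynomial (Fin 3) ℂ) K h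

theorem eq_zero_of_X_mul {a : A14} (h : proj (X 0) * a = 0) : a = 0 := by
  obtain ⟨g, rfl⟩ := proj_surjective a
  rw [← map_mul, proj_eq_zero] at h
  obtain ⟨c, hc⟩ := h
  have hX : (X 0 : MvPolynomial (Fin 4) ℂ) ∣ f14 * c := ⟨g, hc.symm⟩
  rcases X_prime.dvd_or_dvd hX with ⟨e, he⟩ | ⟨e, rfl⟩
  · have := congr(eval ![0, 0, 1, 0] $he)
    simp [f14] at this
  · rw [proj_eq_zero]
    refine ⟨e, mul_left_cancel₀ (X_ne_zero (0 : Fin 4)) ?_⟩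
    rw [hc]
    ring

theorem eq_zero_of_X_pow_mul (n : ℕ) {a : A14} (h : proj (X 0) ^ n * a = 0) : a = 0 := by
  induction n with
  | zero => simpa using h
  | succ n ih => exact ih (eq_zero_of_X_mul (by rw [← h]; ring))

theorem exists_X_pow_mul_eq (a : A14) : ∃ n G, proj (X 0) ^ n * a = proj (incl G) := by
  obtain ⟨p, rfl⟩ := proj_surjective a
  induction p using MvPolynomial.induction_on with
  | C c => exact ⟨0, C c, by simp [incl]⟩
  | add p q hp hq =>
    obtain ⟨n, G, hG⟩ := hp
    obtain ⟨m, H, hH⟩ := hq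
    refine ⟨n + m, X 0 ^ m * G + X 0 ^ n * H, ?_⟩
    have h0 : incl (X 0) = X 0 := rename_X _ _
    simp only [map_add, map_mul, map_pow, h0, ← hG, ← hH]
    ring
  | mul_X p i hp =>
    obtain ⟨n, G, hG⟩ := hp
    have h0 : incl (X 0) = X 0 := rename_X _ _
    have h2 : incl (X 1) = X 2 := rename_X _ _
    have h3 : incl (X 2) = X 3 := rename_X _ _
    by_cases hi : i = 1
    · subst hi
      refine ⟨n + 2, G * -(X 0 + X 1 ^ 2 + X 2 ^ 3), ?_⟩
      simp only [map_add, map_mul, map_pow, map_neg, h0, h2, h3, ← hG, ← proj_relation]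
      ring
    · obtain ⟨j, rfl⟩ := Fin.exists_succAbove_eq hi
      refine ⟨n, G * X j, ?_⟩
      rw [map_mul, map_mul, map_mul, ← hG, incl, rename_X]
      ring

/-- The derivation `x² ∂ᵢ - (∂ᵢ f) ∂_y` of the polynomial ring. -/
noncomputable def preDer (i : Fin 4) :
    Derivation ℂ (MvPolynomial (Fin 4) ℂ) (MvPolynomial (Fin 4) ℂ) :=
  (X 0 ^ 2 : MvPolynomial (Fin 4) ℂ) • pderiv i - pderiv i f14 • pderiv 1

theorem preDer_apply (i : Fin 4) (p : MvPolynomial (Fin 4) ℂ) :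
    preDer i p = X 0 ^ 2 * pderiv i p - pderiv i f14 * pderiv 1 p := rfl

theorem preDer_f14 (i : Fin 4) : preDer i f14 = 0 := by
  have h : pderiv 1 f14 = X 0 ^ 2 := by simp [f14, pderiv_X]
  rw [preDer_apply, h]
  ring

theorem proj_preDer (i : Fin 4) (p : MvPolynomial (Fin 4) ℂ) (hp : proj p = 0) :
    proj (preDer i p) = 0 := by
  obtain ⟨c, rfl⟩ := proj_eq_zero.1 hp
  rw [Derivation.leibniz, preDer_f14, smul_zero, add_zero, smul_eq_mul]
  exact proj_eq_zero.2 (dvd_mul_right _ _)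

/-- The derivation `x² ∂ᵢ - (∂ᵢ f) ∂_y` of the coordinate ring. -/
noncomputable def der (i : Fin 4) : Derivation ℂ A14 A14 :=
  Derivation.liftOfSurjective proj_surjective (proj_preDer i)

theorem der_proj (i : Fin 4) (p : MvPolynomial (Fin 4) ℂ) :
    der i (proj p) = proj (preDer i p) :=
  Derivation.liftOfSurjective_apply proj_surjective (proj_preDer i) p

theorem der_pow_proj (i : Fin 4) (n : ℕ) (p : MvPolynomial (Fin 4) ℂ) :
    ((der i).toLinearMap ^ n) (proj p) = proj (((preDer i).toLinearMap ^ n) p) := by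
  induction n generalizing p with
  | zero => rfl
  | succ n ih =>
    rw [pow_succ, pow_succ, Module.End.mul_apply, Module.End.mul_apply, ← ih]
    exact congr(((der i).toLinearMap ^ n) $(der_proj i p))

theorem preDer_locallyNilpotent {i : Fin 4} (hi : i = 2 ∨ i = 3)
    (p : MvPolynomial (Fin 4) ℂ) : ∃ n : ℕ, ((preDer i).toLinearMap ^ n) p = 0 := by
  have h : (⊤ : Subalgebra ℂ (MvPolynomial (Fin 4) ℂ)) ≤ (preDer i).nilSubalgebra := by
    rw [← adjoin_range_X, Algebra.adjoin_le_iff]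
    rintro _ ⟨j, rfl⟩
    refine ⟨4, ?_⟩
    rcases hi with rfl | rfl <;> fin_cases j <;>
      simp [pow_succ, preDer_apply, f14, pderiv_X, Derivation.leibniz]
  exact h trivial

theorem der_locallyNilpotent {i : Fin 4} (hi : i = 2 ∨ i = 3) (b : A14) :
    ∃ n : ℕ, ((der i).toLinearMap ^ n) b = 0 := by
  obtain ⟨p, rfl⟩ := proj_surjective b
  obtain ⟨n, hn⟩ := preDer_locallyNilpotent hi p
  exact ⟨n, by rw [der_pow_proj, hn, map_zero]⟩

theorem der_incl (j : Fin 3) (G : MvPolynomial (Fin 3) ℂ) :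
    der (Fin.succAbove 1 j) (proj (incl G)) = proj (X 0) ^ 2 * proj (incl (pderiv j G)) := by
  have h : pderiv 1 (incl G) = 0 := pderiv_eq_zero_of_notMem_vars fun h => by
    obtain ⟨k, -, hk⟩ := mem_vars_rename _ _ h
    exact Fin.succAbove_ne _ _ hk
  rw [der_proj, preDer_apply, h, mul_zero, sub_zero,
    pderiv_rename Fin.succAbove_right_injective, map_mul, map_pow]

theorem pderiv_eq_zero_of_der {j : Fin 3} {a : A14} {n : ℕ} {G : MvPolynomial (Fin 3) ℂ}
    (hG : proj (X 0) ^ n * a = proj (incl G)) (h0 : der (Fin.succAbove 1 j) (proj (X 0)) = 0)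
    (ha : der (Fin.succAbove 1 j) a = 0) : pderiv j G = 0 := by
  have h := der_incl j G
  rw [← hG, Derivation.leibniz, Derivation.leibniz_pow, ha, h0] at h
  simp only [smul_zero, add_zero] at h
  exact proj_incl_injective (by simpa using eq_zero_of_X_pow_mul 2 h.symm)

theorem mem_adjoin_of_X_pow_mul {a : A14} {n : ℕ} {q : Polynomial ℂ}
    (h : proj (X 0) ^ n * a = Polynomial.aeval (proj (X 0)) q) :
    a ∈ Algebra.adjoin ℂ {proj (X 0)} := by
  -- a section of `x` over the affine line
  let ψ : A14 →ₐ[ℂ] Polynomial ℂ :=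
    point ![Polynomial.X, Polynomial.C (-1 / 4), 1 - Polynomial.C (1 / 2) * Polynomial.X, -1] (by
      have h4 : (Polynomial.C (-1 / 4) : Polynomial ℂ) = -(Polynomial.C (1 / 2)) ^ 2 := by
        rw [← Polynomial.C_pow, ← Polynomial.C_neg]; norm_num
      have h2 : (Polynomial.C (1 / 2) : Polynomial ℂ) * 2 = 1 := by
        rw [← Polynomial.C_ofNat, ← Polynomial.C_mul]; norm_num
      simp only [h4, Matrix.cons_val]
      linear_combination -Polynomial.X * h2)
  have hx : ψ (proj (X 0)) = Polynomial.X := by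
    rw [point_proj, aeval_X]
    rfl
  have hq : Polynomial.X ^ n * ψ a = q := by
    have := congr(ψ $h)
    rwa [map_mul, map_pow, ← Polynomial.aeval_algHom_apply, hx, Polynomial.aeval_X_left_apply]
      at this
  have ha : a = Polynomial.aeval (proj (X 0)) (ψ a) := by
    rw [← sub_eq_zero]
    apply eq_zero_of_X_pow_mul n
    rw [mul_sub, h, ← hq]
    simp
  rw [ha]
  exact Polynomial.aeval_mem_adjoin_singleton ℂ _

end KorasRussell

/-- The Makar-Limanov invariant of the Koras-Russell cubic threefold is contained in
`ℂ[x]`: every element of `A` killed by all locally nilpotent ℂ-derivations of `A` lies in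
the subalgebra generated by `x`. -/
theorem stmt14 :
    ∀ a : A14,
      (∀ d : Derivation ℂ A14 A14,
        (∀ b : A14, ∃ n : ℕ, (d.toLinearMap ^ n) b = 0) → d a = 0) →
      a ∈ Algebra.adjoin ℂ {Ideal.Quotient.mk (Ideal.span {f14}) (X 0)} := by
  intro a ha
  have hder (j : Fin 3) (hj : Fin.succAbove (1 : Fin 4) j = 2 ∨ Fin.succAbove (1 : Fin 4) j = 3) :=
    ha (KorasRussell.der (Fin.succAbove 1 j)) (KorasRussell.der_locallyNilpotent hj)
  obtain ⟨n, G, hG⟩ := KorasRussell.exists_X_pow_mul_eq a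
  have h0 (j : Fin 3) (hj : j ≠ 0) :
      KorasRussell.der (Fin.succAbove 1 j) (KorasRussell.proj (X 0)) = 0 := by
    rw [KorasRussell.der_proj]
    fin_cases j <;> simp_all [KorasRussell.preDer_apply, pderiv_X, Fin.succAbove]
  have h1 : 1 ∉ G.vars := notMem_vars_of_pderiv_eq_zero
    (KorasRussell.pderiv_eq_zero_of_der hG (h0 1 (by decide)) (hder 1 (by decide)))
  have h2 : 2 ∉ G.vars := notMem_vars_of_pderiv_eq_zero
    (KorasRussell.pderiv_eq_zero_of_der hG (h0 2 (by decide)) (hder 2 (by decide)))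
  have hG0 : G ∈ supported ℂ ({0} : Set (Fin 3)) := by
    rw [mem_supported]
    intro j hj
    fin_cases j
    exacts [rfl, absurd hj h1, absurd hj h2]
  rw [supported_eq_adjoin_X, Set.image_singleton, Algebra.adjoin_singleton_eq_range_aeval] at hG0
  obtain ⟨q, rfl⟩ := hG0
  refine KorasRussell.mem_adjoin_of_X_pow_mul (n := n) (q := q) ?_
  rw [hG]
  change KorasRussell.proj (KorasRussell.incl (Polynomial.aeval (X 0) q)) = _
  rw [← Polynomial.aeval_algHom_apply, ← Polynomial.aeval_algHom_apply]
  simp [KorasRussell.incl]
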